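/- (Fibration extension property) Let p : X → A be a Kan fibration of simplicial sets and let j : A → B be an anodyne map. Then there exist a Kan fibration q : Y → B and a map X → Y over j forming a pullback square, i.e., exhibiting X ≅ A ×_B Y over A. -/

import Mathlib

open CategoryTheory CategoryTheory.Limits Simplicial MonoidalCategory SSet

noncomputable instance : MonoidalClosed SSet.{0} :=
  (inferInstance : MonoidalClosed (SimplexCategoryᵒᵖ ⥤ Type 0))

namespace Paper

/-- A map of simplicial sets is a *trivial fibration* if it has the right lifting
property with respect to all boundary inclusions `∂Δ[n] ⟶ Δ[n]` for `n ≥ 0`. -/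
def TrivialFibration {X Y : SSet.{0}} (p : X ⟶ Y) : Prop :=
  ∀ n : ℕ, HasLiftingProperty (SSet.boundary n).ι p

/-- A map of simplicial sets is a *Kan fibration* if it has the right lifting property
with respect to all horn inclusions `Λ[n, i] ⟶ Δ[n]` for `n ≥ 1`, `0 ≤ i ≤ n`. -/
def KanFibration {X Y : SSet.{0}} (p : X ⟶ Y) : Prop :=
  ∀ (n : ℕ) (i : Fin (n + 2)), HasLiftingProperty (SSet.horn (n + 1) i).ι p

/-- An *anodyne* map is one with the left lifting property with respect to
all Kan fibrations. -/
def Anodyne {A B : SSet.{0}} (i : A ⟶ B) : Prop :=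
  ∀ ⦃X Y : SSet.{0}⦄ (p : X ⟶ Y), KanFibration p → HasLiftingProperty i p

/-- The unique map to `Δ[0]`. -/
def toPt (X : SSet.{0}) : X ⟶ Δ[0] where
  app m := ↾fun _ => SSet.stdSimplex.const 0 0 m
  naturality := by
    intro m m' φ
    ext x
    apply stdSimplex.objEquiv.injective
    apply SimplexCategory.Hom.ext
    apply OrderHom.ext
    funext j
    exact @Subsingleton.elim (Fin 1) _ _ _

/-- A *Kan complex* is a simplicial set whose map to `Δ[0]` is a Kan fibration. -/
def KanComplex (X : SSet.{0}) : Prop :=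
  KanFibration (toPt X)

/-- The constant map at the vertex `k` of `Δ[1]`. -/
def cst (X : SSet.{0}) (k : Fin 2) : X ⟶ Δ[1] where
  app m := ↾fun _ => SSet.stdSimplex.const 1 k m
  naturality := by
    intro m m' φ
    ext x
    apply stdSimplex.objEquiv.injective
    apply SimplexCategory.Hom.ext
    ext j
    rfl

/-- The endpoint inclusion `X ⟶ X ⊗ Δ[1]` at the vertex `k` of `Δ[1]`. -/
noncomputable def ept (X : SSet.{0}) (k : Fin 2) : X ⟶ X ⊗ Δ[1] :=
  CartesianMonoidalCategory.lift (𝟙 X) (cst X k)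

/-- A (single-step) homotopy from `f` to `g`, as a property of the pair `(f, g)`. -/
def Homotopy {X Y : SSet.{0}} (f g : X ⟶ Y) : Prop :=
  ∃ H : X ⊗ Δ[1] ⟶ Y, ept X 0 ≫ H = f ∧ ept X 1 ≫ H = g

/-- `f` and `g` are *homotopic* if they are connected by a zig-zag of homotopies. -/
def Homotopic {X Y : SSet.{0}} (f g : X ⟶ Y) : Prop :=
  Relation.EqvGen Homotopy f g

/-- A *homotopy equivalence* of simplicial sets. -/
def HomotopyEquivalence {X Y : SSet.{0}} (f : X ⟶ Y) : Prop :=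
  ∃ g : Y ⟶ X, Homotopic (f ≫ g) (𝟙 X) ∧ Homotopic (g ≫ f) (𝟙 Y)

/-- A map `f : X ⟶ Y` is a *weak homotopy equivalence* if for every Kan complex `K`
the induced map `K^Y ⟶ K^X` on exponentials is a homotopy equivalence. -/
def WeakHomotopyEquivalence {X Y : SSet.{0}} (f : X ⟶ Y) : Prop :=
  ∀ K : SSet.{0}, KanComplex K → HomotopyEquivalence ((MonoidalClosed.pre f).app K)

/-- A homotopy `H` between maps over `B` which is *fiberwise over `B`*. -/
def FibHomotopy {B X Y : SSet.{0}} (pX : X ⟶ B) (pY : Y ⟶ B) (f g : X ⟶ Y) : Prop :=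
  ∃ H : X ⊗ Δ[1] ⟶ Y, ept X 0 ≫ H = f ∧ ept X 1 ≫ H = g ∧
    H ≫ pY = CartesianMonoidalCategory.fst X Δ[1] ≫ pX

/-- Connectedness by a zig-zag of fiberwise homotopies over `B`. -/
def FibHomotopic {B X Y : SSet.{0}} (pX : X ⟶ B) (pY : Y ⟶ B) (f g : X ⟶ Y) : Prop :=
  Relation.EqvGen (FibHomotopy pX pY) f g

/-- A *fiberwise homotopy equivalence over `B`*. -/
def FibHomotopyEquivalence {B X Y : SSet.{0}} (pX : X ⟶ B) (pY : Y ⟶ B) (f : X ⟶ Y) : Prop :=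
  f ≫ pY = pX ∧ ∃ g : Y ⟶ X, g ≫ pX = pY ∧
    FibHomotopic pX pX (f ≫ g) (𝟙 X) ∧ FibHomotopic pY pY (g ≫ f) (𝟙 Y)

end Paper

section

open HomotopicalAlgebra modelCategoryQuillen

namespace Paper

lemma kanFibration_iff {X Y : SSet.{0}} (p : X ⟶ Y) : KanFibration p ↔ Fibration p := by
  rw [modelCategoryQuillen.fibration_iff]
  constructor
  · intro h A B f hf
    simp only [J, MorphismProperty.iSup_iff] at hf
    obtain ⟨n, ⟨i⟩⟩ := hf
    exact h n i
  · intro h n i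
    exact h _ (horn_ι_mem_J _ _)

lemma hom_ext_app {X Y : SSet.{0}} {f g : X ⟶ Y} (h : ∀ n (x : X.obj n), f.app n x = g.app n x) :
    f = g :=
  NatTrans.ext (funext fun n => ConcreteCategory.hom_ext _ _ (h n))

lemma ept_comp_fst (X : SSet.{0}) (k : Fin 2) :
    ept X k ≫ CartesianMonoidalCategory.fst X Δ[1] = 𝟙 X :=
  CartesianMonoidalCategory.lift_fst _ _

lemma comp_ept {X Y : SSet.{0}} (f : X ⟶ Y) (k : Fin 2) :
    f ≫ ept Y k = ept X k ≫ f ▷ Δ[1] := by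
  exact hom_ext_app fun n x => rfl

lemma mem_horn_one_iff {m : SimplexCategoryᵒᵖ} (k : Fin 2) (t : (Δ[1] : SSet.{0}).obj m) :
    t ∈ (SSet.horn 1 k).obj m ↔ t = stdSimplex.const 1 k m := by
  obtain ⟨d, rfl⟩ : ∃ d : ℕ, m = Opposite.op ⦋d⦌ := ⟨m.unop.len, rfl⟩
  rw [mem_horn_iff_notMem_range]
  constructor
  · rintro ⟨j, hj, hm⟩
    ext i : 1
    have : t i ≠ j := fun h => hm ⟨i, h⟩
    change t i = k
    grind
  · rintro rfl
    refine ⟨1 - k, ?_, ?_⟩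
    · grind
    · rintro ⟨i, hi⟩
      change k = 1 - k at hi
      grind

/-- The relative homotopy extension and lifting property of Kan fibrations. -/
lemma exists_homotopy_lift {L Q R : SSet.{0}} {q : Q ⟶ R} (hq : KanFibration q)
    (K : L.Subcomplex) (k : Fin 2) (f : L ⟶ Q) (F : (K : SSet.{0}) ⊗ Δ[1] ⟶ Q)
    (G : L ⊗ Δ[1] ⟶ R) (hF : ept (K : SSet.{0}) k ≫ F = K.ι ≫ f)
    (hf : f ≫ q = ept L k ≫ G) (hG : F ≫ q = K.ι ▷ Δ[1] ≫ G) :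
    ∃ Φ : L ⊗ Δ[1] ⟶ Q, K.ι ▷ Δ[1] ≫ Φ = F ∧ ept L k ≫ Φ = f ∧ Φ ≫ q = G := by
  have hpush := Subcomplex.unionProd.isPushout K (SSet.horn 1 k)
  have e1 : (K : SSet.{0}) ◁ (SSet.horn 1 k).ι =
      CartesianMonoidalCategory.fst _ _ ≫ ept (K : SSet.{0}) k := by
    refine hom_ext_app fun n xt => ?_
    exact Prod.ext (show xt.1 = xt.1 from rfl) ((mem_horn_one_iff k _).1 xt.2.2)
  have e2 : L ◁ (SSet.horn 1 k).ι = CartesianMonoidalCategory.fst _ _ ≫ ept L k := by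
    refine hom_ext_app fun n xt => ?_
    exact Prod.ext (show xt.1 = xt.1 from rfl) ((mem_horn_one_iff k _).1 xt.2.2)
  have w : K.ι ▷ ((SSet.horn 1 k : SSet.{0})) ≫ CartesianMonoidalCategory.fst _ _ ≫ f =
      (K : SSet.{0}) ◁ (SSet.horn 1 k).ι ≫ F := by
    rw [e1, Category.assoc, hF]; rfl
  have an : anodyneExtensions (K.unionProd (SSet.horn 1 k)).ι :=
    anodyneExtensions_unionProd_ι _ _ (anodyneExtensions.horn_ι k)
  have : HasLiftingProperty (K.unionProd (SSet.horn 1 k)).ι q :=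
    an q ((HomotopicalAlgebra.fibration_iff _).1 ((kanFibration_iff q).1 hq))
  have sq : CommSq (hpush.desc _ _ w) (K.unionProd (SSet.horn 1 k)).ι q G := ⟨by
    apply hpush.hom_ext
    · rw [hpush.inl_desc_assoc, ← Category.assoc, Subcomplex.unionProd.ι₁_ι, e2,
        Category.assoc, Category.assoc, hf]
    · rw [hpush.inr_desc_assoc, ← Category.assoc, Subcomplex.unionProd.ι₂_ι, hG]⟩
  refine ⟨sq.lift, ?_, ?_, sq.fac_right⟩
  · rw [← Subcomplex.unionProd.ι₂_ι, Category.assoc, sq.fac_left, hpush.inr_desc]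
  · have h1 : Subcomplex.unionProd.ι₁ K (SSet.horn 1 k) ≫ (K.unionProd (SSet.horn 1 k)).ι ≫
        sq.lift = CartesianMonoidalCategory.fst _ _ ≫ f := by
      rw [sq.fac_left, hpush.inl_desc]
    rw [← Category.assoc, Subcomplex.unionProd.ι₁_ι] at h1
    let v : L ⟶ L ⊗ (SSet.horn 1 k : SSet.{0}) :=
      CartesianMonoidalCategory.lift (𝟙 L)
        (Subcomplex.lift (cst L k) (by
          rintro n _ ⟨x, rfl⟩
          exact (mem_horn_one_iff k _).2 rfl))
    have h2 := congrArg (fun g => v ≫ g) h1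
    exact h2

/-- A map of simplicial sets given by a natural family of functions. -/
def mkHom {X Y : SSet.{0}} (φ : ∀ n, X.obj n → Y.obj n)
    (hφ : ∀ {n m} (α : n ⟶ m) (x : X.obj n), φ m (X.map α x) = Y.map α (φ n x)) : X ⟶ Y where
  app n := ↾(φ n)
  naturality _ _ α := ConcreteCategory.hom_ext _ _ (hφ α)

lemma app_map {X Y : SSet.{0}} (f : X ⟶ Y) {n m : SimplexCategoryᵒᵖ} (α : n ⟶ m) (x : X.obj n) :
    f.app m (X.map α x) = Y.map α (f.app n x) :=
  NatTrans.naturality_apply f α x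

lemma congr_app {X Y : SSet.{0}} {f g : X ⟶ Y} (h : f = g) {n : SimplexCategoryᵒᵖ} (x : X.obj n) :
    f.app n x = g.app n x := by rw [h]

lemma mono_iff_injective_app {X Y : SSet.{0}} (f : X ⟶ Y) :
    Mono f ↔ ∀ n, Function.Injective (f.app n) := by
  rw [NatTrans.mono_iff_mono_app]
  exact forall_congr' fun n => CategoryTheory.mono_iff_injective _

lemma isPullback_iff_app {P X Y Z : SSet.{0}} (a : P ⟶ X) (b : P ⟶ Y) (f : X ⟶ Z) (g : Y ⟶ Z) :
    IsPullback a b f g ↔ a ≫ f = b ≫ g ∧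
      (∀ n (x y : P.obj n), a.app n x = a.app n y → b.app n x = b.app n y → x = y) ∧
      ∀ n (x : X.obj n) (y : Y.obj n), f.app n x = g.app n y →
        ∃ z, a.app n z = x ∧ b.app n z = y := by
  constructor
  · intro h
    have := fun n => (Types.isPullback_iff _ _ _ _).1 (h.app n)
    exact ⟨h.w, fun n x y h1 h2 => (this n).2.1 x y ⟨h1, h2⟩, fun n => (this n).2.2⟩
  · rintro ⟨h1, h2, h3⟩
    refine IsPullback.of_forall_isPullback_app fun n => ?_
    rw [Types.isPullback_iff]
    refine ⟨?_, fun x y h => h2 n x y h.1 h.2, h3 n⟩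
    rw [← NatTrans.comp_app, h1, NatTrans.comp_app]

lemma isPullback_subcomplex_iff {P Y B : SSet.{0}} (A : B.Subcomplex) (a : P ⟶ A) (b : P ⟶ Y)
    (g : Y ⟶ B) :
    IsPullback a b A.ι g ↔ a ≫ A.ι = b ≫ g ∧ (∀ n, Function.Injective (b.app n)) ∧
      ∀ n (y : Y.obj n), g.app n y ∈ A.obj n → ∃ z, b.app n z = y := by
  rw [isPullback_iff_app]
  refine and_congr_right fun w => and_congr ?_ ?_
  · refine ⟨fun h n x y hxy => h n x y ?_ hxy, fun h n x y _ hxy => h n hxy⟩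
    apply Subtype.ext
    have := congrArg (g.app n) hxy
    exact (congr_app w x).trans (this.trans (congr_app w y).symm)
  · refine forall_congr' fun n => ⟨fun h y hy => ?_, fun h x y hxy => ?_⟩
    · obtain ⟨z, -, hz⟩ := h ⟨_, hy⟩ y rfl
      exact ⟨z, hz⟩
    · obtain ⟨z, rfl⟩ := h y (hxy ▸ x.2)
      exact ⟨z, Subtype.ext ((congr_app w z).trans hxy.symm), rfl⟩

lemma const_ne {m : SimplexCategoryᵒᵖ} :
    (stdSimplex.const 1 1 m : (Δ[1] : SSet.{0}).obj m) ≠ stdSimplex.const 1 0 m := by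
  intro h
  obtain ⟨d, rfl⟩ : ∃ d : ℕ, m = Opposite.op ⦋d⦌ := ⟨m.unop.len, rfl⟩
  have : (1 : Fin 2) = 0 := congrArg (fun t : (Δ[1] : SSet.{0}) _⦋d⦌ => t 0) h
  exact absurd this (by decide)

/-- Trivial fibrations, with the lifting property against all monomorphisms. -/
abbrev TrivFib {X Y : SSet.{0}} (p : X ⟶ Y) : Prop :=
  (MorphismProperty.monomorphisms SSet.{0}).rlp p

open Classical in
/-- A subobject over `V` of a trivial fibration over `V`, itself trivial over `V`, is a strong
deformation retract over `V`. -/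
lemma exists_deformation {X Z V : SSet.{0}} (i : X ⟶ Z) [Mono i] (t : Z ⟶ V) (ht : TrivFib t)
    (hit : TrivFib (i ≫ t)) :
    ∃ (r : Z ⟶ X) (Θ : Z ⊗ Δ[1] ⟶ Z), i ≫ r = 𝟙 X ∧ ept Z 0 ≫ Θ = 𝟙 Z ∧ ept Z 1 ≫ Θ = r ≫ i ∧
      i ▷ Δ[1] ≫ Θ = CartesianMonoidalCategory.fst _ _ ≫ i ∧
      Θ ≫ t = CartesianMonoidalCategory.fst _ _ ≫ t := by
  have := hit i (MorphismProperty.monomorphisms.infer_property i)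
  have sq : CommSq (𝟙 X) i (i ≫ t) t := ⟨by simp⟩
  let r := sq.lift
  have hr : i ≫ r = 𝟙 X := sq.fac_left
  have hrt : r ≫ i ≫ t = t := sq.fac_right
  let P : (Z ⊗ Δ[1]).Subcomplex :=
    { obj := fun n => {x | x.2 = stdSimplex.const 1 0 n ∨ x.2 = stdSimplex.const 1 1 n ∨
        ∃ y, i.app n y = x.1}
      map := by
        rintro n m α x (h | h | ⟨y, hy⟩)
        · exact Or.inl (congrArg (fun s => (Δ[1] : SSet.{0}).map α s) h)
        · exact Or.inr (Or.inl (congrArg (fun s => (Δ[1] : SSet.{0}).map α s) h))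
        · refine Or.inr (Or.inr ⟨X.map α y, ?_⟩)
          rw [app_map, hy]; rfl }
  let g : (P : SSet.{0}) ⟶ Z := mkHom
    (fun n x => if x.1.2 = stdSimplex.const 1 0 n then x.1.1 else i.app n (r.app n x.1.1)) (by
      rintro n m α ⟨⟨z, s⟩, h⟩
      change (if (Δ[1] : SSet.{0}).map α s = stdSimplex.const 1 0 m then Z.map α z
        else i.app m (r.app m (Z.map α z))) =
        Z.map α (if s = stdSimplex.const 1 0 n then z else i.app n (r.app n z))
      have hi : i.app m (r.app m (Z.map α z)) = Z.map α (i.app n (r.app n z)) := by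
        rw [app_map, app_map]
      by_cases hs : s = stdSimplex.const 1 0 n
      · have : (Δ[1] : SSet.{0}).map α s = stdSimplex.const 1 0 m :=
          congrArg (fun s => (Δ[1] : SSet.{0}).map α s) hs
        rw [if_pos hs, if_pos this]
      · rw [if_neg hs, hi]
        split_ifs with h'
        · obtain h | h | ⟨y, hy⟩ := h
          · exact absurd h hs
          · have : (Δ[1] : SSet.{0}).map α s = stdSimplex.const 1 1 m :=
              congrArg (fun s => (Δ[1] : SSet.{0}).map α s) h
            exact absurd (this.symm.trans h') const_ne
          · change i.app n y = z at hy
            subst hy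
            have : r.app n (i.app n y) = y := congr_app hr y
            rw [this]
        · rfl)
  have hg : ∀ n (x : (P : SSet.{0}).obj n), g.app n x =
    if x.1.2 = stdSimplex.const 1 0 n then x.1.1 else i.app n (r.app n x.1.1) := fun n x => rfl
  have hP : CommSq g P.ι t (CartesianMonoidalCategory.fst _ _ ≫ t) := ⟨by
    refine hom_ext_app fun n x => ?_
    change t.app n (g.app n x) = t.app n x.1.1
    rw [hg]
    split_ifs
    · rfl
    · exact congr_app hrt x.1.1⟩
  have := ht P.ι (MorphismProperty.monomorphisms.infer_property _)
  have hl : ∀ n (x : (P : SSet.{0}).obj n), hP.lift.app n x.1 = g.app n x :=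
    fun n x => congr_app hP.fac_left x
  refine ⟨r, hP.lift, hr, ?_, ?_, ?_, hP.fac_right⟩
  · refine hom_ext_app fun n z => ?_
    exact (hl n ⟨(z, stdSimplex.const 1 0 n), Or.inl rfl⟩).trans (if_pos rfl)
  · refine hom_ext_app fun n z => ?_
    exact (hl n ⟨(z, stdSimplex.const 1 1 n), Or.inr (Or.inl rfl)⟩).trans (if_neg const_ne)
  · refine hom_ext_app fun n x => ?_
    refine (hl n ⟨(i.app n x.1, x.2), Or.inr (Or.inr ⟨x.1, rfl⟩)⟩).trans ((hg _ _).trans ?_)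
    change (if x.2 = stdSimplex.const 1 0 n then i.app n x.1
      else i.app n (r.app n (i.app n x.1))) = i.app n x.1
    split_ifs
    · rfl
    · exact congrArg (i.app n) (congr_app hr x.1)

open Classical in
/-- Shrinking a fibration over `B` to a prescribed deformation retract over a subcomplex `A`. -/
lemma exists_shrink {B Q Z V X : SSet.{0}} (A : B.Subcomplex) {q : Q ⟶ B} (hq : KanFibration q)
    {z : Z ⟶ A} {k : Z ⟶ Q} (hz : IsPullback z k A.ι q) (i : X ⟶ Z) [Mono i] (t : Z ⟶ V)
    (v : V ⟶ A) (htv : t ≫ v = z) (ht : TrivFib t) (hit : TrivFib (i ≫ t)) :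
    ∃ (Y : SSet.{0}) (q' : Y ⟶ B) (u : X ⟶ Y) (c : Y ⟶ Q), KanFibration q' ∧
      IsPullback (i ≫ z) u A.ι q' ∧ Mono c ∧ c ≫ q = q' := by
  obtain ⟨r, Θ, hir, hΘ0, hΘ1, hΘi, hΘt⟩ := exists_deformation i t ht hit
  obtain ⟨hw, hkinj, hksurj⟩ := (isPullback_subcomplex_iff _ _ _ _).1 hz
  have hiinj := (mono_iff_injective_app i).1 inferInstance
  have hkA : ∀ n (y : Z.obj n), q.app n (k.app n y) ∈ A.obj n := fun n y => by
    have := congr_app hw y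
    exact this ▸ (z.app n y).2
  let Xb : Q.Subcomplex :=
    { obj := fun n => {y | ∀ m (α : n ⟶ m), q.app m (Q.map α y) ∈ A.obj m →
        ∃ x, k.app m (i.app m x) = Q.map α y}
      map := by
        intro n n' β y hy m α
        have : Q.map α (Q.map β y) = Q.map (β ≫ α) y := (Q.map_comp_apply β α y).symm
        rw [this]
        exact hy m (β ≫ α) }
  have hXbA : ∀ n (y : Q.obj n), y ∈ Xb.obj n → q.app n y ∈ A.obj n →
      ∃ x, k.app n (i.app n x) = y := fun n y hy h => by
    have e : Q.map (𝟙 n) y = y := Q.map_id_apply n y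
    have := hy n (𝟙 n)
    rw [e] at this
    exact this h
  let K : Q.Subcomplex := Xb ⊔ A.preimage q
  have hK : ∀ n (y : Q.obj n), y ∈ K.obj n ↔ y ∈ Xb.obj n ∨ q.app n y ∈ A.obj n :=
    fun n y => Iff.rfl
  choose s hs using hksurj
  have hsk : ∀ n (x : Z.obj n) h, s n (k.app n x) h = x := fun n x h => hkinj n (hs n _ h)
  have hsi : ∀ n (x : X.obj n) (τ : (Δ[1] : SSet.{0}).obj n),
      Θ.app n (i.app n x, τ) = i.app n x := fun n x τ =>
    congr_app hΘi ((x, τ) : (X ⊗ Δ[1]).obj n)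
  have hzΘ : ∀ n (x : Z.obj n) (τ : (Δ[1] : SSet.{0}).obj n),
      q.app n (k.app n (Θ.app n (x, τ))) = q.app n (k.app n x) := fun n x τ => by
    have h1 := congr_app hw (Θ.app n (x, τ))
    have h2 := congr_app hw x
    have h3 : z.app n (Θ.app n (x, τ)) = z.app n x := by
      rw [← htv]
      exact congrArg (v.app n) (congr_app hΘt ((x, τ) : (Z ⊗ Δ[1]).obj n))
    refine h1.symm.trans (Eq.trans ?_ h2)
    exact congrArg (A.ι.app n) h3
  let F : (K : SSet.{0}) ⊗ Δ[1] ⟶ Q := mkHom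
    (fun n y => if h : q.app n y.1.1 ∈ A.obj n then k.app n (Θ.app n (s n y.1.1 h, y.2))
      else y.1.1) (by
    rintro n m α ⟨⟨y, hy⟩, τ⟩
    change (if h : q.app m (Q.map α y) ∈ A.obj m then
        k.app m (Θ.app m (s m (Q.map α y) h, (Δ[1] : SSet.{0}).map α τ)) else Q.map α y) =
      Q.map α (if h : q.app n y ∈ A.obj n then k.app n (Θ.app n (s n y h, τ)) else y)
    by_cases h : q.app n y ∈ A.obj n
    · have h' : q.app m (Q.map α y) ∈ A.obj m := by
        rw [app_map]; exact A.map α h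
      rw [dif_pos h, dif_pos h']
      have e : s m (Q.map α y) h' = Z.map α (s n y h) := by
        apply hkinj
        rw [hs, app_map, hs]
      rw [e, ← app_map k]
      exact congrArg (k.app m)
        (app_map Θ α ((s n y h, τ) : (Z ⊗ Δ[1]).obj n))
    · rw [dif_neg h]
      split_ifs with h'
      · obtain hy | hy := (hK n y).1 hy
        · obtain ⟨x, hx⟩ := hy m α h'
          have e : s m (Q.map α y) h' = i.app m x := by
            apply hkinj
            rw [hs, hx]
          rw [e, hsi, hx]
        · exact absurd hy h
      · rfl)
  have hF : ∀ n (y : (K : SSet.{0}).obj n) (τ : (Δ[1] : SSet.{0}).obj n), F.app n (y, τ) =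
    if h : q.app n y.1 ∈ A.obj n then k.app n (Θ.app n (s n y.1 h, τ)) else y.1 :=
    fun n y τ => rfl
  obtain ⟨Ω, hΩF, hΩ0, hΩq⟩ := exists_homotopy_lift hq K 0 (𝟙 Q) F
    (CartesianMonoidalCategory.fst _ _ ≫ q) (by
      refine hom_ext_app fun n y => ?_
      refine (hF n y (stdSimplex.const 1 0 n)).trans ?_
      change _ = y.1
      split_ifs with h
      · have : Θ.app n (s n y.1 h, stdSimplex.const 1 0 n) = s n y.1 h := congr_app hΘ0 _
        rw [this, hs]
      · rfl) (by rw [← Category.assoc, ept_comp_fst]) (by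
      refine hom_ext_app fun n y => ?_
      refine (congrArg (q.app n) (hF n y.1 y.2)).trans ?_
      change _ = q.app n y.1.1
      split_ifs with h
      · rw [hzΘ, hs]
      · rfl)
  let ρ : Q ⟶ Q := ept Q 1 ≫ Ω
  have hρq : ρ ≫ q = q := by
    rw [Category.assoc, hΩq, ← Category.assoc, ept_comp_fst, Category.id_comp]
  have hρF : ∀ n (y : (K : SSet.{0}).obj n), ρ.app n y.1 = F.app n (y, stdSimplex.const 1 1 n) :=
    fun n y => congr_app hΩF ((y, stdSimplex.const 1 1 n) : ((K : SSet.{0}) ⊗ Δ[1]).obj n)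
  have hρA : ∀ n (y : Q.obj n), q.app n y ∈ A.obj n → ∃ x, k.app n (i.app n x) = ρ.app n y := by
    intro n y h
    refine ⟨r.app n (s n y h), ?_⟩
    refine Eq.symm ((hρF n ⟨y, Or.inr h⟩).trans ((hF _ _ _).trans ((dif_pos h).trans ?_)))
    exact congrArg (k.app n) (congr_app hΘ1 (s n y h))
  have hρX : ∀ n (y : Q.obj n), ρ.app n y ∈ Xb.obj n := by
    intro n y m α h
    rw [← app_map] at h ⊢
    refine hρA m _ ?_
    have := congr_app hρq (Q.map α y)
    exact this ▸ h
  have hρid : ∀ n (y : Q.obj n), y ∈ Xb.obj n → ρ.app n y = y := by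
    intro n y hy
    refine (hρF n ⟨y, Or.inl hy⟩).trans ((hF _ _ _).trans ?_)
    split_ifs with h
    · obtain ⟨x, rfl⟩ := hXbA n y hy h
      have := hsk n (i.app n x) h
      change k.app n (Θ.app n (s n (k.app n (i.app n x)) h, _)) = _
      rw [this, hsi]
    · rfl
  let ρ' : Q ⟶ Xb := Subcomplex.lift ρ (by
    rintro n _ ⟨y, rfl⟩
    exact hρX n y)
  have hρ' : Xb.ι ≫ ρ' = 𝟙 _ := hom_ext_app fun n y => Subtype.ext (hρid n y.1 y.2)
  have hρ'q : ρ' ≫ Xb.ι ≫ q = q := hρq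
  refine ⟨Xb, Xb.ι ≫ q, Subcomplex.lift (i ≫ k) ?_, Xb.ι, fun n j => ⟨fun {f g} sq => ?_⟩, ?_,
    inferInstance, rfl⟩
  · rintro n _ ⟨x, rfl⟩ m α -
    exact ⟨X.map α x, by rw [app_map, app_map]; rfl⟩
  · have := hq n j
    have sq' : CommSq (f ≫ Xb.ι) (horn (n + 1) j).ι q g := ⟨by rw [Category.assoc, sq.w]⟩
    exact ⟨⟨⟨sq'.lift ≫ ρ', by rw [sq'.fac_left_assoc, Category.assoc, hρ', Category.comp_id],
      by rw [Category.assoc, hρ'q, sq'.fac_right]⟩⟩⟩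
  · rw [isPullback_subcomplex_iff]
    refine ⟨?_, fun n x y h => ?_, fun n y hy => ?_⟩
    · rw [Category.assoc, hw]; rfl
    · exact hiinj n (hkinj n (congrArg Subtype.val h))
    · obtain ⟨x, hx⟩ := hXbA n y.1 y.2 hy
      exact ⟨x, Subtype.ext hx⟩

lemma exists_injective_pi {T I : Type} [Inhabited T] [Countable I] {enc : (ℕ → T) → T}
    (henc : Function.Injective enc) : ∃ c : (I → T) → T, Function.Injective c := by
  obtain ⟨e, he⟩ := exists_injective_nat I
  refine ⟨fun f => enc (Function.extend e f fun _ => default), fun f g h => funext fun i => ?_⟩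
  have := congrFun (henc h) (e i)
  rwa [he.extend_apply, he.extend_apply] at this

/-- A map is `T`-small if its fibres inject into `T` in each degree. -/
def Small (T : Type) {X A : SSet.{0}} (p : X ⟶ A) : Prop :=
  ∃ φ : ∀ n, X.obj n → T, ∀ n (x y : X.obj n), p.app n x = p.app n y → φ n x = φ n y → x = y

/-- The cofree simplicial set on a type. -/
def cofree (T : Type) : SSet.{0} where
  obj n := (Σ k : SimplexCategoryᵒᵖ, (n ⟶ k)) → T
  map α := ↾fun f x => f ⟨x.1, α ≫ x.2⟩

/-- The map to a cofree simplicial set attached to a family of functions. -/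
def toCofree {T : Type} {Y : SSet.{0}} (φ : ∀ n, Y.obj n → T) : Y ⟶ cofree T :=
  mkHom (fun _ y x => φ x.1 (Y.map x.2 y)) fun {n m} α y => by
    funext x
    exact congrArg (φ x.1) (Y.map_comp_apply α x.2 y).symm

lemma toCofree_app_id {T : Type} {Y : SSet.{0}} (φ : ∀ n, Y.obj n → T) (n : SimplexCategoryᵒᵖ)
    (y : Y.obj n) : (toCofree φ).app n y ⟨n, 𝟙 n⟩ = φ n y :=
  congrArg (φ n) (Y.map_id_apply n y)

lemma hom_cofree_apply {T : Type} {Y : SSet.{0}} (f : Y ⟶ cofree T) {n : SimplexCategoryᵒᵖ}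
    (y : Y.obj n) (x : Σ k : SimplexCategoryᵒᵖ, (n ⟶ k)) :
    f.app n y x = f.app x.1 (Y.map x.2 y) ⟨x.1, 𝟙 x.1⟩ := by
  rw [app_map]
  change _ = f.app n y ⟨x.1, x.2 ≫ 𝟙 x.1⟩
  rw [Category.comp_id]

lemma hom_cofree_ext {T : Type} {Y : SSet.{0}} {f g : Y ⟶ cofree T}
    (h : ∀ n (y : Y.obj n), f.app n y ⟨n, 𝟙 n⟩ = g.app n y ⟨n, 𝟙 n⟩) : f = g :=
  hom_ext_app fun n y => funext fun x => by
    rw [hom_cofree_apply f, hom_cofree_apply g, h]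

open Classical in
lemma exists_extension_cofree {T : Type} [Inhabited T] {K L : SSet.{0}} (f : K ⟶ L) [Mono f]
    (g : K ⟶ cofree T) : ∃ h : L ⟶ cofree T, f ≫ h = g := by
  let φ : ∀ n, L.obj n → T := fun n y =>
    if h : ∃ x, f.app n x = y then g.app n h.choose ⟨n, 𝟙 n⟩ else default
  refine ⟨toCofree φ, hom_cofree_ext fun n x => (toCofree_app_id φ n (f.app n x)).trans ?_⟩
  dsimp only [φ]
  have h : ∃ x', f.app n x' = f.app n x := ⟨x, rfl⟩
  rw [dif_pos h, (mono_iff_injective_app f).1 inferInstance n h.choose_spec]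

lemma TrivFib.kanFibration {X Y : SSet.{0}} {p : X ⟶ Y} (hp : TrivFib p) : KanFibration p :=
  fun _ _ => hp _ (MorphismProperty.monomorphisms.infer_property _)

lemma trivFib_fst_cofree (T : Type) [Inhabited T] (V : SSet.{0}) :
    TrivFib (CartesianMonoidalCategory.fst V (cofree T)) := by
  intro K L f hf
  have : Mono f := hf
  refine ⟨fun {u w} sq => ?_⟩
  obtain ⟨h, hh⟩ := exists_extension_cofree f (u ≫ CartesianMonoidalCategory.snd _ _)
  refine ⟨⟨⟨CartesianMonoidalCategory.lift w h, ?_, ?_⟩⟩⟩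
  · apply CartesianMonoidalCategory.hom_ext
    · rw [Category.assoc, CartesianMonoidalCategory.lift_fst, sq.w]
    · rw [Category.assoc, CartesianMonoidalCategory.lift_snd, hh]
  · rw [CartesianMonoidalCategory.lift_fst]

lemma KanFibration.comp {X Y Z : SSet.{0}} {p : X ⟶ Y} {q : Y ⟶ Z} (hp : KanFibration p)
    (hq : KanFibration q) : KanFibration (p ≫ q) := fun n i => by
  have := hp n i
  have := hq n i
  infer_instance

lemma KanFibration.of_isPullback {X Y X' Y' : SSet.{0}} {p : X ⟶ Y} {f : X' ⟶ X} {p' : X' ⟶ Y'}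
    {g : Y' ⟶ Y} (hp : KanFibration p) (h : IsPullback f p' p g) : KanFibration p' := fun n i => by
  have := hp n i
  exact h.hasLiftingProperty _

section

variable {T : Type}

lemma Small.of_mono {Y Q B : SSet.{0}} {q : Q ⟶ B} (hq : Small T q) (c : Y ⟶ Q) [Mono c] :
    Small T (c ≫ q) := by
  obtain ⟨φ, hφ⟩ := hq
  exact ⟨fun n y => φ n (c.app n y), fun n x y h h' =>
    (mono_iff_injective_app c).1 inferInstance n (hφ n _ _ h h')⟩

lemma Small.of_isPullback {X Y X' Y' : SSet.{0}} {p : X ⟶ Y} {f : X' ⟶ X} {p' : X' ⟶ Y'}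
    {g : Y' ⟶ Y} (hp : Small T p) (h : IsPullback f p' p g) : Small T p' := by
  obtain ⟨φ, hφ⟩ := hp
  obtain ⟨hw, hinj, -⟩ := (isPullback_iff_app _ _ _ _).1 h
  refine ⟨fun n y => φ n (f.app n y), fun n x y e e' => hinj n x y (hφ n _ _ ?_ e') e⟩
  exact (congr_app hw x).trans ((congrArg (g.app n) e).trans (congr_app hw y).symm)

variable [Inhabited T] {enc : (ℕ → T) → T}

lemma Small.comp (henc : Function.Injective enc) {X Y Z : SSet.{0}} {p : X ⟶ Y} {q : Y ⟶ Z}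
    (hp : Small T p) (hq : Small T q) : Small T (p ≫ q) := by
  obtain ⟨φ, hφ⟩ := hp
  obtain ⟨ψ, hψ⟩ := hq
  obtain ⟨c, hc⟩ := exists_injective_pi (I := Bool) henc
  refine ⟨fun n x => c fun b => if b then φ n x else ψ n (p.app n x), fun n x y e e' => ?_⟩
  have h := hc e'
  exact hφ n _ _ (hψ n _ _ e (congrFun h false)) (congrFun h true)

instance (n : SimplexCategoryᵒᵖ) (k : SimplexCategoryᵒᵖ) : Finite (n ⟶ k) :=
  Finite.of_equiv (k.unop ⟶ n.unop) (opEquiv n k).symm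

instance : Countable SimplexCategoryᵒᵖ :=
  Function.Injective.countable (f := fun n : SimplexCategoryᵒᵖ => n.unop.len) fun _ _ h =>
    Opposite.unop_injective (SimplexCategory.ext h)

lemma small_fst_cofree (henc : Function.Injective enc) (B : SSet.{0}) :
    Small T (CartesianMonoidalCategory.fst B (cofree T)) := by
  choose c hc using fun n : SimplexCategoryᵒᵖ =>
    exists_injective_pi (I := Σ k : SimplexCategoryᵒᵖ, (n ⟶ k)) henc
  exact ⟨fun n x => c n x.2, fun n x y e e' => Prod.ext e (hc n e')⟩

end

lemma Small.exists_mono {T : Type} {X A : SSet.{0}} {p : X ⟶ A} (hp : Small T p) :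
    ∃ e : X ⟶ cofree T, ∀ n (x y : X.obj n), p.app n x = p.app n y → e.app n x = e.app n y →
      x = y := by
  obtain ⟨φ, hφ⟩ := hp
  refine ⟨toCofree φ, fun n x y e e' => hφ n x y e ?_⟩
  rw [← toCofree_app_id φ, e', toCofree_app_id]

/-- `exists_homotopy_lift` for a monomorphism in place of a subcomplex. -/
lemma exists_homotopy_lift_of_mono {K L Q R : SSet.{0}} {q : Q ⟶ R} (hq : KanFibration q)
    (j : K ⟶ L) [Mono j] (k : Fin 2) (f : L ⟶ Q) (F : K ⊗ Δ[1] ⟶ Q)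
    (G : L ⊗ Δ[1] ⟶ R) (hF : ept K k ≫ F = j ≫ f)
    (hf : f ≫ q = ept L k ≫ G) (hG : F ≫ q = j ▷ Δ[1] ≫ G) :
    ∃ Φ : L ⊗ Δ[1] ⟶ Q, j ▷ Δ[1] ≫ Φ = F ∧ ept L k ≫ Φ = f ∧ Φ ≫ q = G := by
  let e := asIso (Subcomplex.toRange j)
  have he : e.hom ≫ (Subcomplex.range j).ι = j := rfl
  have he' : (Subcomplex.range j).ι = e.inv ≫ j := (Iso.eq_inv_comp e).2 he
  obtain ⟨Φ, h1, h2, h3⟩ := exists_homotopy_lift hq (Subcomplex.range j) k f (e.inv ▷ Δ[1] ≫ F) G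
    (by rw [← Category.assoc, ← comp_ept, Category.assoc, hF, he', Category.assoc]) hf
    (by rw [Category.assoc, hG, he', comp_whiskerRight, Category.assoc])
  refine ⟨Φ, ?_, h2, h3⟩
  rw [← he, comp_whiskerRight, Category.assoc, h1, ← comp_whiskerRight_assoc, e.hom_inv_id,
    id_whiskerRight, Category.id_comp]

/-- The universal object carrying a lift of the homotopy `H` along `p`. -/
lemma exists_pathObject {A X : SSet.{0}} (p : X ⟶ A) (H : A ⊗ Δ[1] ⟶ A) :
    ∃ (Z : SSet.{0}) (a : Z ⟶ A) (γ : Z ⊗ Δ[1] ⟶ X), γ ≫ p = a ▷ Δ[1] ≫ H ∧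
      (∀ (L : SSet.{0}) (b : L ⟶ A) (δ : L ⊗ Δ[1] ⟶ X), δ ≫ p = b ▷ Δ[1] ≫ H →
        ∃ l : L ⟶ Z, l ≫ a = b ∧ l ▷ Δ[1] ≫ γ = δ) ∧
      ∀ (L : SSet.{0}) (l l' : L ⟶ Z), l ≫ a = l' ≫ a → l ▷ Δ[1] ≫ γ = l' ▷ Δ[1] ≫ γ →
        l = l' := by
  let tr {L Y : SSet.{0}} (δ : L ⊗ Δ[1] ⟶ Y) : L ⟶ (ihom Δ[1]).obj Y :=
    MonoidalClosed.curry ((β_ Δ[1] L).hom ≫ δ)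
  have tr_inj : ∀ {L Y : SSet.{0}} (δ δ' : L ⊗ Δ[1] ⟶ Y), tr δ = tr δ' → δ = δ' := by
    intro L Y δ δ' h
    simpa [tr] using MonoidalClosed.curry_injective h
  have tr_comp : ∀ {L Y Y' : SSet.{0}} (δ : L ⊗ Δ[1] ⟶ Y) (g : Y ⟶ Y'),
      tr δ ≫ (ihom Δ[1]).map g = tr (δ ≫ g) := by
    intro L Y Y' δ g
    simp only [tr]
    rw [← MonoidalClosed.curry_natural_right, Category.assoc]
  have comp_tr : ∀ {L L' Y : SSet.{0}} (l : L' ⟶ L) (δ : L ⊗ Δ[1] ⟶ Y),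
      l ≫ tr δ = tr (l ▷ Δ[1] ≫ δ) := by
    intro L L' Y l δ
    simp only [tr]
    rw [← MonoidalClosed.curry_natural_left, BraidedCategory.braiding_naturality_right_assoc]
  have tr_surj : ∀ {L Y : SSet.{0}} (g : L ⟶ (ihom Δ[1]).obj Y), ∃ δ, tr δ = g := by
    intro L Y g
    exact ⟨(β_ Δ[1] L).inv ≫ MonoidalClosed.uncurry g, by simp [tr]⟩
  obtain ⟨γ, hγ⟩ := tr_surj (pullback.fst ((ihom Δ[1]).map p) (tr H))
  refine ⟨pullback ((ihom Δ[1]).map p) (tr H), pullback.snd _ _, γ, ?_, ?_, ?_⟩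
  · apply tr_inj
    rw [← tr_comp, hγ, pullback.condition, comp_tr]
  · intro L b δ h
    refine ⟨pullback.lift (tr δ) b (by rw [tr_comp, comp_tr, h]), pullback.lift_snd _ _ _, ?_⟩
    apply tr_inj
    rw [← comp_tr, hγ, pullback.lift_fst]
  · intro L l l' h1 h2
    refine pullback.hom_ext ?_ h1
    rw [← hγ, comp_tr, comp_tr, h2]

instance (k : SimplexCategoryᵒᵖ) : Finite ((Δ[1] : SSet.{0}).obj k) :=
  Finite.of_equiv (k.unop ⟶ ⦋1⦌) (stdSimplex.objEquiv (n := ⦋1⦌) (m := k)).symm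

lemma small_pathObject {T : Type} [Inhabited T] {enc : (ℕ → T) → T}
    (henc : Function.Injective enc) {A X Z : SSet.{0}} {p : X ⟶ A} (hp : Small T p)
    {H : A ⊗ Δ[1] ⟶ A} {a : Z ⟶ A} {γ : Z ⊗ Δ[1] ⟶ X} (hγ : γ ≫ p = a ▷ Δ[1] ≫ H)
    (hinj : ∀ (L : SSet.{0}) (l l' : L ⟶ Z), l ≫ a = l' ≫ a →
      l ▷ Δ[1] ≫ γ = l' ▷ Δ[1] ≫ γ → l = l') :
    Small T a := by
  obtain ⟨ψ, hψ⟩ := hp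
  choose c hc using fun n : SimplexCategoryᵒᵖ =>
    exists_injective_pi (I := Σ k : SimplexCategoryᵒᵖ, (n ⟶ k) × (Δ[1] : SSet.{0}).obj k) henc
  refine ⟨fun n z => c n fun x => ψ x.1 (γ.app x.1 (Z.map x.2.1 z, x.2.2)),
    fun n z z' h h' => ?_⟩
  have h' := hc n h'
  apply (yonedaEquiv (X := Z) (n := n.unop)).symm.injective
  apply hinj
  · rw [yonedaEquiv_symm_comp, yonedaEquiv_symm_comp]
    exact congrArg _ h
  · refine hom_ext_app fun k x => hψ k _ _ ?_ ?_
    · have key : ∀ w : Z.obj n, p.app k (((yonedaEquiv (n := n.unop)).symm w ▷ Δ[1] ≫ γ).app k x) =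
          H.app k (A.map (stdSimplex.objEquiv x.1).op (a.app n w), x.2) := by
        intro w
        refine (congr_app hγ ((Z.map (stdSimplex.objEquiv x.1).op w, x.2) :
          (Z ⊗ Δ[1]).obj k)).trans ?_
        exact congrArg (fun b => H.app k (b, x.2)) (app_map a _ w)
      rw [key, key, h]
    · exact congrFun h' ⟨k, (stdSimplex.objEquiv x.1).op, x.2⟩

lemma trivFib_id (X : SSet.{0}) : TrivFib (𝟙 X) := fun _ _ _ _ => inferInstance

lemma TrivFib.exists_section {X Y : SSet.{0}} {p : X ⟶ Y} (hp : TrivFib p) :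
    ∃ s : Y ⟶ X, s ≫ p = 𝟙 Y := by
  have := hp (⊥ : Y.Subcomplex).ι (MorphismProperty.monomorphisms.infer_property _)
  have sq : CommSq (Subcomplex.isInitialBot.to X) (⊥ : Y.Subcomplex).ι p (𝟙 Y) :=
    ⟨Subcomplex.isInitialBot.hom_ext _ _⟩
  exact ⟨sq.lift, sq.fac_right⟩

/-- Small fibrations extend along the inclusion of a subcomplex which is homotopic, within
itself, to the restriction of a map defined on the ambient simplicial set. -/
lemma exists_extension {T : Type} [Inhabited T] {enc : (ℕ → T) → T}
    (henc : Function.Injective enc) {X B : SSet.{0}} (A : B.Subcomplex) {p : X ⟶ A}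
    (hp : KanFibration p) (hp' : Small T p) (m : B ⟶ A) (H : (A : SSet.{0}) ⊗ Δ[1] ⟶ A)
    (ε ε' : Fin 2) (h0 : ept A ε ≫ H = 𝟙 _) (h1 : ept A ε' ≫ H = A.ι ≫ m) :
    ∃ (Y : SSet.{0}) (q : Y ⟶ B) (u : X ⟶ Y), KanFibration q ∧ Small T q ∧
      IsPullback p u A.ι q := by
  obtain ⟨Z, a, γ, hγ, hZ, hZ'⟩ := exists_pathObject p H
  have hev : ∀ (L : SSet.{0}) (l : L ⟶ Z) (k : Fin 2), l ≫ ept Z k ≫ γ = ept L k ≫ l ▷ Δ[1] ≫ γ :=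
    fun L l k => by rw [← Category.assoc, comp_ept, Category.assoc]
  have hevp : ∀ k : Fin 2, (ept Z k ≫ γ) ≫ p = a ≫ ept A k ≫ H := fun k => by
    rw [Category.assoc, hγ, ← Category.assoc, ← comp_ept, Category.assoc]
  have he0 : (ept Z ε ≫ γ) ≫ p = a := by rw [hevp, h0, Category.comp_id]
  have he1 : (ept Z ε' ≫ γ) ≫ p = a ≫ A.ι ≫ m := by rw [hevp, h1]
  let W := pullback p m
  let wX : W ⟶ X := pullback.fst _ _
  let wB : W ⟶ B := pullback.snd _ _
  have hW : IsPullback wX wB p m := IsPullback.of_hasPullback _ _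
  let V := pullback p (A.ι ≫ m)
  let vX : V ⟶ X := pullback.fst _ _
  let vA : V ⟶ A := pullback.snd _ _
  have hV : IsPullback vX vA p (A.ι ≫ m) := IsPullback.of_hasPullback _ _
  let g : V ⟶ W := hW.lift vX (vA ≫ A.ι) (by rw [hV.w, Category.assoc])
  have hgX : g ≫ wX = vX := hW.lift_fst _ _ _
  have hgB : g ≫ wB = vA ≫ A.ι := hW.lift_snd _ _ _
  have hg : IsPullback g vA wB A.ι := by
    refine IsPullback.of_right ?_ hgB hW
    rw [hgX]
    exact hV
  let fV := CartesianMonoidalCategory.fst V (cofree T)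
  let fW := CartesianMonoidalCategory.fst W (cofree T)
  have hVW : IsPullback (g ▷ cofree T) fV fW g := by
    rw [isPullback_iff_app]
    refine ⟨rfl, fun n x y h h' => Prod.ext h'
      (show x.2 = y.2 from congrArg (fun w : (W ⊗ cofree T).obj n => w.2) h), fun n x y h => ?_⟩
    exact ⟨(y, x.2), Prod.ext h.symm rfl, rfl⟩
  have hQ : IsPullback (fV ≫ vA) (g ▷ cofree T) A.ι (fW ≫ wB) :=
    (hVW.paste_vert hg).flip
  have kanQ : KanFibration (fW ≫ wB) :=
    (trivFib_fst_cofree T W).kanFibration.comp (hp.of_isPullback hW)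
  have smallQ : Small T (fW ≫ wB) :=
    Small.comp henc (small_fst_cofree henc W) (hp'.of_isPullback hW)
  obtain ⟨e, he⟩ := (small_pathObject henc hp' hγ hZ').exists_mono
  let b : Z ⟶ V := hV.lift (ept Z ε' ≫ γ) a he1
  have hbX : b ≫ vX = ept Z ε' ≫ γ := hV.lift_fst _ _ _
  have hbA : b ≫ vA = a := hV.lift_snd _ _ _
  let i : Z ⟶ V ⊗ cofree T := CartesianMonoidalCategory.lift b e
  have hi : i ≫ fV = b := CartesianMonoidalCategory.lift_fst _ _
  have hi' : i ≫ CartesianMonoidalCategory.snd _ _ = e := CartesianMonoidalCategory.lift_snd _ _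
  have : Mono i := by
    rw [mono_iff_injective_app]
    intro n x y h
    refine he n x y ?_ ?_
    · rw [← hbA, ← hi]
      exact congrArg (fun w => vA.app n (fV.app n w)) h
    · rw [← hi']
      exact congrArg (fun w => (CartesianMonoidalCategory.snd V (cofree T)).app n w) h
  have triv_b : TrivFib b := by
    intro K L f hf
    have : Mono f := hf
    refine ⟨fun {u w} sq => ?_⟩
    obtain ⟨Φ, hΦ1, hΦ2, hΦ3⟩ := exists_homotopy_lift_of_mono hp f ε' (w ≫ vX) (u ▷ Δ[1] ≫ γ)
      ((w ≫ vA) ▷ Δ[1] ≫ H)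
      (by rw [← hev, ← hbX, ← Category.assoc, sq.w, Category.assoc])
      (by rw [Category.assoc, hV.w, ← Category.assoc, ← h1, ← Category.assoc, comp_ept,
        Category.assoc])
      (by rw [Category.assoc, hγ, ← comp_whiskerRight_assoc, ← comp_whiskerRight_assoc, ← hbA,
        ← Category.assoc, sq.w, Category.assoc])
    obtain ⟨l, hl1, hl2⟩ := hZ L (w ≫ vA) Φ hΦ3
    refine ⟨⟨⟨l, hZ' _ _ _ ?_ ?_, hV.hom_ext ?_ ?_⟩⟩⟩
    · rw [Category.assoc, hl1, ← hbA, ← Category.assoc, ← Category.assoc, sq.w]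
    · rw [comp_whiskerRight, Category.assoc, hl2, hΦ1]
    · rw [Category.assoc, hbX, hev, hl2, hΦ2]
    · rw [Category.assoc, hbA, hl1]
  have triv_ev : TrivFib (ept Z ε ≫ γ) := by
    intro K L f hf
    have : Mono f := hf
    refine ⟨fun {u w} sq => ?_⟩
    have hua : u ≫ a = f ≫ w ≫ p := by
      rw [← he0, ← Category.assoc, sq.w, Category.assoc]
    obtain ⟨Φ, hΦ1, hΦ2, hΦ3⟩ := exists_homotopy_lift_of_mono hp f ε w (u ▷ Δ[1] ≫ γ)
      ((w ≫ p) ▷ Δ[1] ≫ H)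
      (by rw [← hev, sq.w])
      (by rw [← Category.assoc, ← comp_ept, Category.assoc, h0, Category.comp_id])
      (by rw [Category.assoc, hγ, ← comp_whiskerRight_assoc, ← comp_whiskerRight_assoc, hua])
    obtain ⟨l, hl1, hl2⟩ := hZ L (w ≫ p) Φ hΦ3
    refine ⟨⟨⟨l, hZ' _ _ _ ?_ ?_, ?_⟩⟩⟩
    · rw [Category.assoc, hl1, hua]
    · rw [comp_whiskerRight, Category.assoc, hl2, hΦ1]
    · rw [hev, hl2, hΦ2]
  obtain ⟨Y₁, q₁, u₁, c₁, hq₁, hu₁, hc₁, hcq₁⟩ := exists_shrink A kanQ hQ i fV vA rfl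
    (trivFib_fst_cofree T V) (by rw [hi]; exact triv_b)
  have hia : i ≫ fV ≫ vA = a := by rw [← Category.assoc, hi, hbA]
  rw [hia] at hu₁
  obtain ⟨s, hs⟩ := triv_ev.exists_section
  have : Mono s := mono_of_mono_fac hs
  obtain ⟨Y, q, u, c, hq, hu, hc, hcq⟩ := exists_shrink A hq₁ hu₁ s (ept Z ε ≫ γ) p he0 triv_ev
    (by rw [hs]; exact trivFib_id X)
  refine ⟨Y, q, u, hq, ?_, ?_⟩
  · have := smallQ.of_mono (c ≫ c₁)
    rwa [Category.assoc, hcq₁, hcq] at this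
  · rwa [← he0, ← Category.assoc, hs, Category.id_comp] at hu

lemma stdSimplex_ext {n : ℕ} {k : SimplexCategoryᵒᵖ} {x y : (Δ[n] : SSet.{0}).obj k}
    (h : ∀ j, stdSimplex.asOrderHom x j = stdSimplex.asOrderHom y j) : x = y :=
  stdSimplex.objEquiv.injective (SimplexCategory.Hom.ext _ _ (OrderHom.ext _ _ (funext h)))

lemma mem_horn_iff_exists {n : ℕ} (i : Fin (n + 1)) {k : SimplexCategoryᵒᵖ}
    (x : (Δ[n] : SSet.{0}).obj k) :
    x ∈ (horn n i).obj k ↔ ∃ j, j ≠ i ∧ ∀ l, stdSimplex.asOrderHom x l ≠ j := by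
  rw [mem_horn_iff, Set.ne_univ_iff_exists_notMem]
  simp only [Set.mem_union, Set.mem_range, Set.mem_singleton_iff, not_or, not_exists]
  exact exists_congr fun j => and_comm

/-- The homotopy of a standard simplex attached to a monotone map on vertices. -/
def vertexHomotopy {n : ℕ} (c : Fin (n + 1) × Fin 2 →o Fin (n + 1)) :
    (Δ[n] : SSet.{0}) ⊗ Δ[1] ⟶ Δ[n] :=
  mkHom (fun k x => stdSimplex.objMk (n := ⦋n⦌) (m := k)
    (c.comp ((stdSimplex.asOrderHom x.1).prod (stdSimplex.asOrderHom x.2)))) fun _ _ => rfl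

lemma exists_horn_homotopy_of_orderHom {n : ℕ} (i : Fin (n + 2))
    (c : Fin (n + 2) × Fin 2 →o Fin (n + 2)) (ε ε' : Fin 2)
    (hc : ∀ x t, c (x, t) = x ∨ c (x, t) = i)
    (hε : ∀ x, c (x, ε) = x) (j : Fin (n + 2)) (hj : j ≠ i) (hε' : ∀ x, c (x, ε') ≠ j) :
    ∃ (m : (Δ[n + 1] : SSet.{0}) ⟶ (horn (n + 1) i : SSet.{0}))
      (H : (horn (n + 1) i : SSet.{0}) ⊗ Δ[1] ⟶ (horn (n + 1) i : SSet.{0})),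
      ept (horn (n + 1) i : SSet.{0}) ε ≫ H = 𝟙 _ ∧
        ept (horn (n + 1) i : SSet.{0}) ε' ≫ H = (horn (n + 1) i).ι ≫ m := by
  refine ⟨Subcomplex.lift (ept Δ[n + 1] ε' ≫ vertexHomotopy c) ?_,
    Subcomplex.lift ((horn (n + 1) i).ι ▷ Δ[1] ≫ vertexHomotopy c) ?_, ?_, ?_⟩
  · rintro k _ ⟨x, rfl⟩
    rw [mem_horn_iff_exists]
    exact ⟨j, hj, fun l => hε' (stdSimplex.asOrderHom x l)⟩
  · rintro k _ ⟨⟨⟨x, hx⟩, t⟩, rfl⟩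
    rw [mem_horn_iff_exists] at hx ⊢
    obtain ⟨j, hj, hx⟩ := hx
    refine ⟨j, hj, fun l => ?_⟩
    change c (stdSimplex.asOrderHom x l, stdSimplex.asOrderHom t l) ≠ j
    rcases hc (stdSimplex.asOrderHom x l) (stdSimplex.asOrderHom t l) with h | h
    · rw [h]; exact hx l
    · rw [h]; exact hj.symm
  · exact hom_ext_app fun k x => Subtype.ext (stdSimplex_ext fun l => hε _)
  · exact hom_ext_app fun k x => rfl

/-- A horn is homotopic, within itself, to the restriction of a map from the simplex. -/
lemma exists_horn_homotopy {n : ℕ} (i : Fin (n + 2)) : ∃ (ε ε' : Fin 2)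
    (m : (Δ[n + 1] : SSet.{0}) ⟶ (horn (n + 1) i : SSet.{0}))
    (H : (horn (n + 1) i : SSet.{0}) ⊗ Δ[1] ⟶ (horn (n + 1) i : SSet.{0})),
    ept (horn (n + 1) i : SSet.{0}) ε ≫ H = 𝟙 _ ∧
      ept (horn (n + 1) i : SSet.{0}) ε' ≫ H = (horn (n + 1) i).ι ≫ m := by
  by_cases hi : i = 0
  · refine ⟨1, 0, exists_horn_homotopy_of_orderHom i
      ⟨fun x => if x.2 = 1 then x.1 else 0, ?_⟩ 1 0 ?_ ?_ 1 ?_ ?_⟩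
    · rintro ⟨x, s⟩ ⟨y, t⟩ ⟨h1, h2⟩
      change x ≤ y at h1
      change s ≤ t at h2
      dsimp only
      split_ifs with h3 h4
      · exact h1
      · exact absurd h2 (by grind)
      · exact Fin.zero_le _
      · exact le_rfl
    · intro x t
      change (if t = 1 then x else 0) = x ∨ (if t = 1 then x else 0) = i
      split_ifs
      · exact Or.inl rfl
      · exact Or.inr hi.symm
    · exact fun x => rfl
    · rw [hi]; exact one_ne_zero
    · exact fun x => (Fin.zero_ne_one : (0 : Fin (n + 2)) ≠ 1)
  · refine ⟨0, 1, exists_horn_homotopy_of_orderHom i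
      ⟨fun x => if x.2 = 0 then x.1 else max x.1 i, ?_⟩ 0 1 ?_ ?_ 0 ?_ ?_⟩
    · rintro ⟨x, s⟩ ⟨y, t⟩ ⟨h1, h2⟩
      change x ≤ y at h1
      change s ≤ t at h2
      dsimp only
      split_ifs with h3 h4 h4
      · exact h1
      · exact h1.trans (le_max_left _ _)
      · exact absurd h2 (by grind)
      · exact max_le_max h1 le_rfl
    · intro x t
      change (if t = 0 then x else max x i) = x ∨ (if t = 0 then x else max x i) = i
      split_ifs
      · exact Or.inl rfl
      · exact max_choice x i
    · exact fun x => rfl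
    · exact fun h => hi h.symm
    · intro x
      change max x i ≠ 0
      have := le_max_right x i
      grind

lemma kanFibration_of_forall_simplex {X B : SSet.{0}} {p : X ⟶ B}
    (h : ∀ (n : ℕ) (w : Δ[n] ⟶ B), ∃ (P : SSet.{0}) (a : P ⟶ X) (b : P ⟶ Δ[n]),
      IsPullback a b p w ∧ KanFibration b) : KanFibration p := fun n i => ⟨fun {u w} sq => by
  obtain ⟨P, a, b, hab, hb⟩ := h _ w
  have := hb n i
  have sq' : CommSq (hab.lift u (horn (n + 1) i).ι sq.w) (horn (n + 1) i).ι b (𝟙 _) := ⟨by simp⟩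
  refine ⟨⟨⟨sq'.lift ≫ a, ?_, ?_⟩⟩⟩
  · rw [← Category.assoc, sq'.fac_left, hab.lift_fst]
  · rw [Category.assoc, hab.w, ← Category.assoc, sq'.fac_right, Category.id_comp]⟩

section

variable {E : SSet.{0}}

lemma preimage_id_whiskerRight {A : SSet.{0}} (S : (A ⊗ E).Subcomplex) :
    S.preimage (𝟙 A ▷ E) = S := by
  rw [id_whiskerRight, Subcomplex.preimage_id]

lemma preimage_comp_whiskerRight {A B C : SSet.{0}} (f : A ⟶ B) (g : B ⟶ C)
    (S : (C ⊗ E).Subcomplex) :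
    S.preimage ((f ≫ g) ▷ E) = (S.preimage (g ▷ E)).preimage (f ▷ E) := by
  rw [comp_whiskerRight, Subcomplex.preimage_comp]

lemma isPullback_preimage {A B : SSet.{0}} (f : A ⟶ B) (S : (B ⊗ E).Subcomplex) :
    ∃ a : (S.preimage (f ▷ E) : SSet.{0}) ⟶ S,
      IsPullback a ((S.preimage (f ▷ E)).ι ≫ CartesianMonoidalCategory.fst _ _)
        (S.ι ≫ CartesianMonoidalCategory.fst _ _) f := by
  refine ⟨S.fromPreimage (f ▷ E), ?_⟩
  rw [isPullback_iff_app]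
  refine ⟨rfl, fun n x y h h' => Subtype.ext (Prod.ext h' ?_), fun n x y h => ?_⟩
  · exact congrArg (fun z : (S : SSet.{0}).obj n => z.1.2) h
  · obtain ⟨⟨x, e⟩, hx⟩ := x
    change x = f.app n y at h
    subst h
    exact ⟨⟨(y, e), hx⟩, rfl, rfl⟩

lemma KanFibration.preimage {A B : SSet.{0}} {S : (B ⊗ E).Subcomplex}
    (hS : KanFibration (S.ι ≫ CartesianMonoidalCategory.fst B E)) (f : A ⟶ B) :
    KanFibration ((S.preimage (f ▷ E)).ι ≫ CartesianMonoidalCategory.fst A E) :=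
  hS.of_isPullback (isPullback_preimage f S).choose_spec

lemma KanFibration.range {X Y Z : SSet.{0}} (f : X ⟶ Y) [Mono f] (g : Y ⟶ Z)
    (h : KanFibration (f ≫ g)) : KanFibration ((Subcomplex.range f).ι ≫ g) := by
  refine h.of_isPullback (f := inv (Subcomplex.toRange f)) (g := 𝟙 _)
    (IsPullback.of_horiz_isIso ⟨?_⟩)
  rw [IsIso.inv_comp_eq, Category.comp_id]
  rfl

variable (E) in
/-- The simplicial set classifying Kan fibrations embedded in a product with `E`. -/
noncomputable def kanUniverse : SSet.{0} where
  obj n := {S : (stdSimplex.obj n.unop ⊗ E).Subcomplex //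
    KanFibration (S.ι ≫ CartesianMonoidalCategory.fst _ _)}
  map α := ↾fun S => ⟨S.1.preimage (SSet.stdSimplex.map α.unop ▷ E), S.2.preimage _⟩
  map_id n := by
    refine ConcreteCategory.hom_ext _ _ fun S => Subtype.ext ?_
    exact (congrArg (fun g => S.1.preimage (g ▷ E)) (SSet.stdSimplex.map_id n.unop)).trans
      (preimage_id_whiskerRight S.1)
  map_comp α β := by
    refine ConcreteCategory.hom_ext _ _ fun S => Subtype.ext ?_
    exact (congrArg (fun g => S.1.preimage (g ▷ E)) (SSet.stdSimplex.map_comp β.unop α.unop)).trans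
      (preimage_comp_whiskerRight _ _ S.1)

/-- The map to `kanUniverse E` classifying an embedded Kan fibration. -/
noncomputable def classify {A : SSet.{0}} (S : (A ⊗ E).Subcomplex)
    (hS : KanFibration (S.ι ≫ CartesianMonoidalCategory.fst A E)) : A ⟶ kanUniverse E :=
  mkHom (fun n x => ⟨S.preimage ((SSet.yonedaEquiv (X := A) (n := n.unop)).symm x ▷ E),
    hS.preimage _⟩) fun {n m} α x => Subtype.ext (by
      change S.preimage (SSet.yonedaEquiv.symm (A.map α x) ▷ E) =
        (S.preimage (SSet.yonedaEquiv.symm x ▷ E)).preimage (SSet.stdSimplex.map α.unop ▷ E)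
      have : (SSet.yonedaEquiv (X := A) (n := m.unop)).symm (A.map α x) =
          SSet.stdSimplex.map α.unop ≫ (SSet.yonedaEquiv (X := A) (n := n.unop)).symm x :=
        hom_ext_app fun k y => (A.map_comp_apply α _ x).symm
      rw [this, preimage_comp_whiskerRight])

/-- The embedded Kan fibration classified by a map to `kanUniverse E`. -/
noncomputable def total {B : SSet.{0}} (f : B ⟶ kanUniverse E) : (B ⊗ E).Subcomplex where
  obj n := {x | ((stdSimplex.objEquiv.symm (𝟙 n.unop), x.2) : (stdSimplex.obj n.unop ⊗ E).obj n) ∈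
    (f.app n x.1).1.obj n}
  map := by
    rintro n m α ⟨b, e⟩ h
    have h' := (f.app n b).1.map α h
    change _ ∈ (f.app m (B.map α b)).1.obj m
    rw [app_map]
    change (stdSimplex.objEquiv.symm (𝟙 m.unop ≫ α.unop), _) ∈ (f.app n b).1.obj m
    change (stdSimplex.objEquiv.symm (α.unop ≫ 𝟙 n.unop), _) ∈ (f.app n b).1.obj m at h'
    rw [Category.comp_id] at h'
    rw [Category.id_comp]
    exact h'

lemma preimage_total {B : SSet.{0}} (f : B ⟶ kanUniverse E) {n : SimplexCategoryᵒᵖ} (b : B.obj n) :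
    (total f).preimage ((SSet.yonedaEquiv (X := B) (n := n.unop)).symm b ▷ E) = (f.app n b).1 := by
  ext k ⟨σ, e⟩
  obtain ⟨α, rfl⟩ := stdSimplex.objEquiv.symm.surjective σ
  change (stdSimplex.objEquiv.symm (𝟙 k.unop), e) ∈ (f.app k (B.map α.op b)).1.obj k ↔ _
  rw [app_map]
  change (stdSimplex.objEquiv.symm (𝟙 k.unop ≫ α), e) ∈ (f.app n b).1.obj k ↔ _
  rw [Category.id_comp]
  rfl

lemma kanFibration_total {B : SSet.{0}} (f : B ⟶ kanUniverse E) :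
    KanFibration ((total f).ι ≫ CartesianMonoidalCategory.fst B E) :=
  kanFibration_of_forall_simplex fun n w => by
    obtain ⟨b, rfl⟩ := SSet.yonedaEquiv.symm.surjective w
    obtain ⟨a, ha⟩ := isPullback_preimage (SSet.yonedaEquiv.symm b) (total f)
    refine ⟨_, a, _, ha, ?_⟩
    rw [preimage_total f b]
    exact (f.app _ b).2

lemma total_classify {A : SSet.{0}} (S : (A ⊗ E).Subcomplex)
    (hS : KanFibration (S.ι ≫ CartesianMonoidalCategory.fst A E)) : total (classify S hS) = S := by
  ext n ⟨x, e⟩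
  have : A.map (𝟙 n.unop).op x = x := A.map_id_apply n x
  exact iff_of_eq (congrArg (fun x => ((x, e) : (A ⊗ E).obj n) ∈ S.obj n) this)

lemma comp_classify {A B : SSet.{0}} (j : A ⟶ B) (S : (B ⊗ E).Subcomplex)
    (hS : KanFibration (S.ι ≫ CartesianMonoidalCategory.fst B E)) (f : A ⟶ kanUniverse E)
    (h : S.preimage (j ▷ E) = total f) : j ≫ classify S hS = f :=
  hom_ext_app fun n x => Subtype.ext (by
    rw [← preimage_total f x, ← h]
    change S.preimage (SSet.yonedaEquiv.symm (j.app n x) ▷ E) = _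
    rw [← yonedaEquiv_symm_comp, preimage_comp_whiskerRight])

end

open Classical in
/-- Extension of a Kan fibration embedded in a product with a cofree simplicial set. -/
lemma exists_extension_subcomplex {T : Type} [Inhabited T] {enc : (ℕ → T) → T}
    (henc : Function.Injective enc) {B : SSet.{0}} (A : B.Subcomplex)
    (S : ((A : SSet.{0}) ⊗ cofree T).Subcomplex)
    (hS : KanFibration (S.ι ≫ CartesianMonoidalCategory.fst _ _))
    (m : B ⟶ A) (H : (A : SSet.{0}) ⊗ Δ[1] ⟶ A)
    (ε ε' : Fin 2) (h0 : ept A ε ≫ H = 𝟙 _) (h1 : ept A ε' ≫ H = A.ι ≫ m) :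
    ∃ S' : (B ⊗ cofree T).Subcomplex, KanFibration (S'.ι ≫ CartesianMonoidalCategory.fst _ _) ∧
      S'.preimage (A.ι ▷ cofree T) = S := by
  obtain ⟨Y, q, u, hq, ⟨φ, hφ⟩, hpb⟩ := exists_extension henc A hS
    ((small_fst_cofree henc _).of_mono S.ι) m H ε ε' h0 h1
  obtain ⟨hw, hinj, hsurj⟩ := (isPullback_subcomplex_iff _ _ _ _).1 hpb
  let φ' : ∀ n, Y.obj n → T := fun n y =>
    if h : ∃ x, u.app n x = y then h.choose.1.2 ⟨n, 𝟙 n⟩ else φ n y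
  have hφ'u : ∀ n x, φ' n (u.app n x) = x.1.2 ⟨n, 𝟙 n⟩ := fun n x => by
    have h : ∃ x', u.app n x' = u.app n x := ⟨x, rfl⟩
    dsimp only [φ']
    rw [dif_pos h, hinj n h.choose_spec]
  have hφ'u' : ∀ n y, (¬ ∃ x, u.app n x = y) → φ' n y = φ n y := fun n y h => dif_neg h
  have hu : u ≫ toCofree φ' = S.ι ≫ CartesianMonoidalCategory.snd _ _ :=
    hom_cofree_ext fun n x => (toCofree_app_id φ' n (u.app n x)).trans (hφ'u n x)
  let f : Y ⟶ B ⊗ cofree T := CartesianMonoidalCategory.lift q (toCofree φ')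
  have hf : Mono f := (mono_iff_injective_app f).2 fun n x y hxy => by
    have hq' : q.app n x = q.app n y := congrArg Prod.fst hxy
    have he : (toCofree φ').app n x = (toCofree φ').app n y := congrArg Prod.snd hxy
    by_cases hx : q.app n x ∈ A.obj n
    · obtain ⟨x, rfl⟩ := hsurj n x hx
      obtain ⟨y, rfl⟩ := hsurj n y (hq' ▸ hx)
      refine congrArg (u.app n) (Subtype.ext (Prod.ext (Subtype.ext ?_) ?_))
      · exact (congr_app hw x).trans (hq'.trans (congr_app hw y).symm)
      · exact (congr_app hu x).symm.trans (he.trans (congr_app hu y))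
    · have hA : ∀ y', q.app n y' ∉ A.obj n → ¬ ∃ x, u.app n x = y' := by
        rintro _ h ⟨x, rfl⟩
        exact h (congr_app hw x ▸ Subtype.property _)
      refine hφ n x y hq' ?_
      rw [← hφ'u' n x (hA x hx), ← hφ'u' n y (hA y (hq' ▸ hx)), ← toCofree_app_id φ', he,
        toCofree_app_id]
  refine ⟨Subcomplex.range f, KanFibration.range f _ ?_, ?_⟩
  · rwa [CartesianMonoidalCategory.lift_fst]
  · ext n ⟨a, e⟩
    constructor
    · rintro ⟨y, hy⟩
      have hqy : q.app n y = a.1 := congrArg Prod.fst hy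
      have hey : (toCofree φ').app n y = e := congrArg Prod.snd hy
      obtain ⟨x, rfl⟩ := hsurj n y (hqy ▸ a.2)
      have : x.1 = (a, e) := Prod.ext (Subtype.ext ((congr_app hw x).trans hqy))
        ((congr_app hu x).symm.trans hey)
      exact this ▸ x.2
    · intro h
      exact ⟨u.app n ⟨_, h⟩, Prod.ext (congr_app hw ⟨_, h⟩).symm (congr_app hu ⟨_, h⟩)⟩

lemma kanComplex_kanUniverse {T : Type} [Inhabited T] {enc : (ℕ → T) → T}
    (henc : Function.Injective enc) : KanComplex (kanUniverse (cofree T)) :=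
  fun n i => ⟨fun {f w} sq => by
    obtain ⟨ε, ε', m, H, h0, h1⟩ := exists_horn_homotopy i
    obtain ⟨S, hS, hSf⟩ := exists_extension_subcomplex henc (horn (n + 1) i) (total f)
      (kanFibration_total f) m H ε ε' h0 h1
    exact ⟨⟨⟨classify S hS, comp_classify _ S hS f hSf, hom_ext_app fun k x =>
      stdSimplex_ext fun l => @Subsingleton.elim (Fin 1) _ _ _⟩⟩⟩⟩

end Paper

end

/-- Fibration extension property. Kan fibrations extend along
anodyne maps. -/
theorem fibration_extension {X A B : SSet.{0}} (p : X ⟶ A) (hp : Paper.KanFibration p)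
    (j : A ⟶ B) (hj : Paper.Anodyne j) :
    ∃ (Y : SSet.{0}) (q : Y ⟶ B) (u : X ⟶ Y),
      Paper.KanFibration q ∧ IsPullback p u j q := by
  let T := ℕ → Option (Σ n : SimplexCategoryᵒᵖ, X.obj n)
  let enc : (ℕ → T) → T := fun f k => f k.unpair.1 k.unpair.2
  have henc : Function.Injective enc := fun f g h => funext fun a => funext fun b => by
    simpa [enc] using congrFun h (Nat.pair a b)
  have : Inhabited T := ⟨fun _ => none⟩
  have hsmall : Paper.Small T p := ⟨fun n x _ => some ⟨n, x⟩, fun n x y _ h => by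
    simpa using congrFun h 0⟩
  obtain ⟨e, he⟩ := hsmall.exists_mono
  let f : X ⟶ A ⊗ Paper.cofree T := CartesianMonoidalCategory.lift p e
  have hf : Mono f := (Paper.mono_iff_injective_app f).2 fun n x y h =>
    he n x y (congrArg Prod.fst h) (congrArg Prod.snd h)
  have hS : Paper.KanFibration ((Subcomplex.range f).ι ≫ CartesianMonoidalCategory.fst _ _) :=
    Paper.KanFibration.range f _ (by rwa [CartesianMonoidalCategory.lift_fst])
  have := hj _ (Paper.kanComplex_kanUniverse henc)
  have sq : CommSq (Paper.classify _ hS) j (Paper.toPt (Paper.kanUniverse (Paper.cofree T)))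
    (Paper.toPt B) := ⟨Paper.hom_ext_app fun _ _ => rfl⟩
  have hg : (Paper.total sq.lift).preimage (j ▷ Paper.cofree T) = Subcomplex.range f := by
    have : (Paper.total sq.lift).preimage (j ▷ Paper.cofree T) = Paper.total (j ≫ sq.lift) := rfl
    rw [this, sq.fac_left, Paper.total_classify]
  have hfg : ∀ n (a : A.obj n) (c : (Paper.cofree T).obj n),
      ((j.app n a, c) : (B ⊗ Paper.cofree T).obj n) ∈ (Paper.total sq.lift).obj n ↔
        ∃ x, p.app n x = a ∧ e.app n x = c := fun n a c => by
    have : ((a, c) : (A ⊗ Paper.cofree T).obj n) ∈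
        ((Paper.total sq.lift).preimage (j ▷ Paper.cofree T)).obj n ↔
      ((a, c) : (A ⊗ Paper.cofree T).obj n) ∈ (Subcomplex.range f).obj n := by rw [hg]
    exact this.trans (exists_congr fun x => Prod.ext_iff)
  refine ⟨_, _, Subcomplex.lift (f ≫ j ▷ Paper.cofree T) ?_,
    Paper.kanFibration_total sq.lift, ?_⟩
  · rintro n _ ⟨x, rfl⟩
    exact (hfg n _ _).2 ⟨x, rfl, rfl⟩
  · rw [Paper.isPullback_iff_app]
    refine ⟨rfl, fun n x y h h' => he n x y h ?_, fun n a y h => ?_⟩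
    · exact congrArg (fun z => z.1.2) h'
    · obtain ⟨⟨b, c⟩, hy⟩ := y
      change j.app n a = b at h
      subst h
      obtain ⟨x, rfl, rfl⟩ := (hfg n a c).1 hy
      exact ⟨x, rfl, rfl⟩
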